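/- Let J₊ = diag(−1,1,1,1) and for t > 0 let α(t) ∈ ℝ⁴ satisfy −α₀(t)² + α₁(t)² + α₂(t)² + α₃(t)² = 1, and define the reflection matrix r_t = Id − 2·J₊·α(t)·α(t)ᵀ. Assume that, as t → 0⁺, α_j(t)/t → b_j for j = 0, 1, 2 and α₃(t) → 1. Then τ_t · r_t · τ_t⁻¹ converges, as t → 0⁺, to the 4×4 matrix whose upper-left 3×3 block is the identity, whose entries (0,3), (1,3), (2,3) are 0, and whose last row is (−2b₀, −2b₁, −2b₂, −1). -/

import Mathlib

open Matrix Filter Topology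

/-- The projective rescaling `τ_t = diag(1,1,1,1/|t|)`. -/
noncomputable def tauRescale (t : ℝ) : Matrix (Fin 4) (Fin 4) ℝ :=
  Matrix.diagonal ![1, 1, 1, 1 / |t|]

theorem tauRescale_inv {t : ℝ} (ht : 0 < t) :
    (tauRescale t)⁻¹ = Matrix.diagonal ![1, 1, 1, t] := by
  refine Matrix.inv_eq_right_inv ?_
  rw [tauRescale, abs_of_pos ht, diagonal_mul_diagonal, ← diagonal_one]
  congr 1
  funext i
  fin_cases i <;> simp [ht.ne']

/-- The rescaled reflection is again a rank-one perturbation of the identity, with factors that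
stay bounded as `t → 0⁺`. -/
theorem tauRescale_conj_reflection {t : ℝ} (ht : 0 < t) (a : Fin 4 → ℝ) :
    tauRescale t * (1 - (2 : ℝ) • (Matrix.diagonal ![-1, 1, 1, 1] * vecMulVec a a)) *
        (tauRescale t)⁻¹ =
      1 - (2 : ℝ) • vecMulVec ![-(a 0 / t * t ^ 2), a 1 / t * t ^ 2, a 2 / t * t ^ 2, a 3]
        ![a 0 / t, a 1 / t, a 2 / t, a 3] := by
  rw [tauRescale_inv ht, tauRescale, abs_of_pos ht]
  ext i j
  rw [mul_diagonal, diagonal_mul]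
  simp only [Matrix.sub_apply, Matrix.smul_apply, diagonal_mul, vecMulVec_apply, smul_eq_mul]
  fin_cases i <;> fin_cases j <;> simp <;> field_simp

/-- Rescaled limits of hyperbolic reflections `r_t = Id − 2 J₊ α(t) α(t)ᵀ` along planes whose
rescalings converge to a spacelike plane of `HP³` are half-pipe reflections. -/
theorem rescaled_hyperbolic_reflection_tendsto_halfpipe_reflection
    (α : ℝ → Fin 4 → ℝ) (b₀ b₁ b₂ : ℝ)
    (hunit : ∀ t ∈ Set.Ioi (0 : ℝ),
      -(α t 0) ^ 2 + (α t 1) ^ 2 + (α t 2) ^ 2 + (α t 3) ^ 2 = 1)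
    (h0 : Tendsto (fun t : ℝ => α t 0 / t) (nhdsWithin 0 (Set.Ioi 0)) (nhds b₀))
    (h1 : Tendsto (fun t : ℝ => α t 1 / t) (nhdsWithin 0 (Set.Ioi 0)) (nhds b₁))
    (h2 : Tendsto (fun t : ℝ => α t 2 / t) (nhdsWithin 0 (Set.Ioi 0)) (nhds b₂))
    (h3 : Tendsto (fun t : ℝ => α t 3) (nhdsWithin 0 (Set.Ioi 0)) (nhds 1)) :
    Tendsto
      (fun t : ℝ =>
        tauRescale t *
          (1 - (2 : ℝ) • (Matrix.diagonal ![-1, 1, 1, 1] * Matrix.vecMulVec (α t) (α t))) *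
        (tauRescale t)⁻¹)
      (nhdsWithin 0 (Set.Ioi 0))
      (nhds !![1, 0, 0, 0;
               0, 1, 0, 0;
               0, 0, 1, 0;
               -2 * b₀, -2 * b₁, -2 * b₂, -1]) := by
  have ht : Tendsto (fun t : ℝ => t ^ 2) (𝓝[>] 0) (𝓝 0) := by
    have h : Tendsto (fun t : ℝ => t ^ 2) (𝓝 0) (𝓝 (0 ^ 2)) := tendsto_id.pow 2
    simpa using h.mono_left nhdsWithin_le_nhds
  have hu : Tendsto (fun t => ![-(α t 0 / t * t ^ 2), α t 1 / t * t ^ 2, α t 2 / t * t ^ 2, α t 3])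
      (𝓝[>] 0) (𝓝 ![-(b₀ * 0), b₁ * 0, b₂ * 0, 1]) := by
    rw [tendsto_pi_nhds]
    intro i
    fin_cases i
    exacts [(h0.mul ht).neg, h1.mul ht, h2.mul ht, h3]
  have hw : Tendsto (fun t => ![α t 0 / t, α t 1 / t, α t 2 / t, α t 3])
      (𝓝[>] 0) (𝓝 ![b₀, b₁, b₂, 1]) := by
    rw [tendsto_pi_nhds]
    intro i
    fin_cases i
    exacts [h0, h1, h2, h3]
  have hlim : !![1, 0, 0, 0; 0, 1, 0, 0; 0, 0, 1, 0; -2 * b₀, -2 * b₁, -2 * b₂, -1] =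
      1 - (2 : ℝ) • vecMulVec ![-(b₀ * 0), b₁ * 0, b₂ * 0, 1] ![b₀, b₁, b₂, 1] := by
    ext i j
    simp only [Matrix.sub_apply, Matrix.smul_apply, vecMulVec_apply, smul_eq_mul]
    fin_cases i <;> fin_cases j <;> simp
    norm_num
  have hcont : Continuous fun p : (Fin 4 → ℝ) × (Fin 4 → ℝ) =>
      (1 : Matrix (Fin 4) (Fin 4) ℝ) - (2 : ℝ) • vecMulVec p.1 p.2 :=
    continuous_const.sub
      ((continuous_fst.matrix_vecMulVec continuous_snd).fun_const_smul 2)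
  rw [hlim]
  refine ((hcont.tendsto _).comp (hu.prodMk_nhds hw)).congr' ?_
  filter_upwards [self_mem_nhdsWithin] with t ht
  exact (tauRescale_conj_reflection ht (α t)).symm
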